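/- arXiv:2307.15866 — 3 statements merged into one kernel-verified Lean document; each statement's English description precedes it below -/
import Mathlib

section
/- Let W be a Γ-graded g-module and v a nonzero vector of W_0 such that: (i) W is generated by v as a g-module; (ii) g_γ · v = 0 for every γ ∈ Γ with γ ≻ 0 (i.e. γ ⪰ 0 and γ ≠ 0); (iii) W_0 = ℂv; (iv) W_γ = 0 unless γ ⪯ 0; (v) the only graded g-submodules of W are 0 and W. Then the only g-submodules of W are 0 and W, i.e. W is an irreducible g-module. -/
/-- The projection of an internally graded module onto its component of degree `γ`, viewed as an
endomorphism. -/
noncomputable def gradedComponent {ι R M : Type*} [DecidableEq ι] [Semiring R] [AddCommMonoid M]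
    [Module R M] (ℳ : ι → Submodule R M) [DirectSum.Decomposition ℳ] (i : ι) : M →ₗ[R] M :=
  (ℳ i).subtype ∘ₗ DirectSum.component R ι (fun j => ℳ j) i ∘ₗ
    (DirectSum.decomposeLinearEquiv ℳ).toLinearMap

section gradedComponent

variable {ι R M : Type*} [DecidableEq ι] [Semiring R] [AddCommMonoid M] [Module R M]
  (ℳ : ι → Submodule R M) [DirectSum.Decomposition ℳ]

theorem gradedComponent_apply (i : ι) (x : M) :
    gradedComponent ℳ i x = DirectSum.decompose ℳ x i := rfl

theorem gradedComponent_mem (i : ι) (x : M) : gradedComponent ℳ i x ∈ ℳ i :=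
  (DirectSum.decompose ℳ x i).2

theorem gradedComponent_of_mem {i : ι} {x : M} (hx : x ∈ ℳ i) : gradedComponent ℳ i x = x :=
  DirectSum.decompose_of_mem_same ℳ hx

theorem gradedComponent_of_mem_ne {i j : ι} {x : M} (hx : x ∈ ℳ i) (hij : i ≠ j) :
    gradedComponent ℳ j x = 0 :=
  DirectSum.decompose_of_mem_ne ℳ hx hij

theorem eq_gradedComponent_of_forall_ne {i : ι} {x : M}
    (h : ∀ j, j ≠ i → gradedComponent ℳ j x = 0) : x = gradedComponent ℳ i x := by
  classical
  conv_lhs => rw [← DirectSum.sum_support_decompose ℳ x]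
  refine Finset.sum_eq_single i (fun j _ hj => h j hj) fun hi => ?_
  simpa using hi

theorem exists_minimal_gradedComponent_ne_zero [PartialOrder ι] {x : M} (hx : x ≠ 0) :
    ∃ i, Minimal (fun j => gradedComponent ℳ j x ≠ 0) i := by
  classical
  have hne : (DirectSum.decompose ℳ x).support.Nonempty := by
    rw [Finset.nonempty_iff_ne_empty, Ne, DFinsupp.support_eq_empty]
    exact fun h => hx ((DirectSum.decompose ℳ).injective (h.trans (DirectSum.decompose_zero ℳ).symm))
  obtain ⟨i, hi⟩ := Finset.exists_minimal hne
  refine ⟨i, ?_⟩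
  simpa [gradedComponent_apply] using hi

end gradedComponent

section GradedLieModule

variable {Γ R L W : Type*} [AddCommGroup Γ] [DecidableEq Γ] [CommRing R] [LieRing L]
  [LieAlgebra R L] [AddCommGroup W] [Module R W] [LieRingModule L W]
  {gL : Γ → Submodule R L} (gW : Γ → Submodule R W) [DirectSum.Decomposition gW]

/-- A homogeneous element of the Lie algebra shifts components of a graded module. -/
theorem gradedComponent_lie
    (hact : ∀ γ δ : Γ, ∀ x ∈ gL γ, ∀ w ∈ gW δ, ⁅x, w⁆ ∈ gW (γ + δ))
    {γ : Γ} {x : L} (hx : x ∈ gL γ) (δ : Γ) (w : W) :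
    gradedComponent gW (γ + δ) ⁅x, w⁆ = ⁅x, gradedComponent gW δ w⁆ := by
  induction w using DirectSum.Decomposition.inductionOn gW with
  | zero => simp
  | @homogeneous i m =>
    by_cases h : i = δ
    · subst h
      rw [gradedComponent_of_mem gW (hact _ _ _ hx _ m.2), gradedComponent_of_mem gW m.2]
    · rw [gradedComponent_of_mem_ne gW (hact _ _ _ hx _ m.2) (by simpa using h),
        gradedComponent_of_mem_ne gW m.2 h, lie_zero]
  | add a b ha hb => simp [ha, hb]

/-- A family of subspaces that is stable under the homogeneous elements of a graded Lie algebra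
spans a Lie submodule. -/
def gradedLieSubmodule (hgL : ⨆ γ, gL γ = ⊤) (P : Γ → Submodule R W)
    (hP : ∀ γ δ : Γ, ∀ x ∈ gL γ, ∀ w ∈ P δ, ⁅x, w⁆ ∈ P (γ + δ)) : LieSubmodule R L W where
  toSubmodule := ⨆ δ, P δ
  lie_mem {x w} hw := by
    change w ∈ ⨆ δ, P δ at hw
    change ⁅x, w⁆ ∈ ⨆ δ, P δ
    have hx : x ∈ ⨆ γ, gL γ := hgL ▸ Submodule.mem_top
    induction hx using Submodule.iSup_induction' with
    | zero => simp
    | add x y _ _ hx hy => rw [add_lie]; exact add_mem hx hy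
    | mem γ x hx =>
      induction hw using Submodule.iSup_induction' with
      | zero => simp
      | add w z _ _ hw hz => rw [lie_add]; exact add_mem hw hz
      | mem δ w hw => exact Submodule.mem_iSup_of_mem (γ + δ) (hP γ δ x hx w hw)

/-- The vectors of `U` whose support is contained in the support of `u` translated by `σ`. -/
noncomputable def shiftedSupport (U : Submodule R W) (u : W) (σ : Γ) : Submodule R W :=
  U ⊓ ⨅ (ε : Γ) (_ : gradedComponent gW (ε - σ) u = 0), LinearMap.ker (gradedComponent gW ε)

theorem mem_shiftedSupport {U : Submodule R W} {u : W} {σ : Γ} {w : W} :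
    w ∈ shiftedSupport gW U u σ ↔
      w ∈ U ∧ ∀ ε, gradedComponent gW (ε - σ) u = 0 → gradedComponent gW ε w = 0 := by
  simp [shiftedSupport]

theorem lie_mem_shiftedSupport
    (hact : ∀ γ δ : Γ, ∀ x ∈ gL γ, ∀ w ∈ gW δ, ⁅x, w⁆ ∈ gW (γ + δ))
    (U : LieSubmodule R L W) {u : W} {σ γ : Γ} {x : L} (hx : x ∈ gL γ) {w : W}
    (hw : w ∈ shiftedSupport gW (U : Submodule R W) u σ) :
    ⁅x, w⁆ ∈ shiftedSupport gW (U : Submodule R W) u (γ + σ) := by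
  rw [mem_shiftedSupport] at hw ⊢
  refine ⟨U.lie_mem hw.1, fun ε hε => ?_⟩
  have h := gradedComponent_lie gW hact hx (ε - γ) w
  rw [add_sub_cancel] at h
  rw [h, hw.2 (ε - γ) (by rwa [sub_sub]), lie_zero]

/-- In a graded-irreducible module, every homogeneous vector is a component of an element of `U`
whose support is a translate of the support of a given `u ∈ U`. -/
theorem exists_mem_shiftedSupport (hgL : ⨆ γ, gL γ = ⊤)
    (hact : ∀ γ δ : Γ, ∀ x ∈ gL γ, ∀ w ∈ gW δ, ⁅x, w⁆ ∈ gW (γ + δ))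
    (hgraded : ∀ U : LieSubmodule R L W,
      (U : Submodule R W) = ⨆ γ : Γ, (U : Submodule R W) ⊓ gW γ → U = ⊥ ∨ U = ⊤)
    (U : LieSubmodule R L W) {u : W} (hu : u ∈ U) {γ δ : Γ} (hγ : gradedComponent gW γ u ≠ 0)
    {v : W} (hv : v ∈ gW δ) :
    ∃ w ∈ shiftedSupport gW (U : Submodule R W) u (δ - γ), gradedComponent gW δ w = v := by
  let P : Γ → Submodule R W := fun η =>
    (shiftedSupport gW (U : Submodule R W) u (η - γ)).map (gradedComponent gW η)
  have hPle : ∀ η, P η ≤ gW η := by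
    rintro η _ ⟨w, -, rfl⟩
    exact gradedComponent_mem gW η w
  have hP : ∀ ε η : Γ, ∀ x ∈ gL ε, ∀ w ∈ P η, ⁅x, w⁆ ∈ P (ε + η) := by
    rintro ε η x hx _ ⟨w, hw, rfl⟩
    refine ⟨⁅x, w⁆, ?_, gradedComponent_lie gW hact hx η w⟩
    rw [add_sub_assoc]
    exact lie_mem_shiftedSupport gW hact U hx hw
  let N := gradedLieSubmodule hgL P hP
  have hN : (N : Submodule R W) = ⨆ η, P η := rfl
  have huN : gradedComponent gW γ u ∈ (N : Submodule R W) := by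
    rw [hN]
    refine Submodule.mem_iSup_of_mem γ ⟨u, ?_, rfl⟩
    rw [SetLike.mem_coe, mem_shiftedSupport]
    exact ⟨hu, fun ε hε => by simpa using hε⟩
  have hNtop : N = ⊤ := by
    refine (hgraded N (le_antisymm ?_ (iSup_le fun _ => inf_le_left))).resolve_left ?_
    · exact hN.le.trans (iSup_mono fun η => le_inf (hN ▸ le_iSup P η) (hPle η))
    · rintro h
      rw [h] at huN
      exact hγ (by simpa using huN)
  have hmap : ⨆ η, P η ≤ (P δ).comap (gradedComponent gW δ) := by
    refine iSup_le fun η w hw => ?_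
    rw [Submodule.mem_comap]
    by_cases h : η = δ
    · subst h
      rwa [gradedComponent_of_mem gW (hPle _ hw)]
    · rw [gradedComponent_of_mem_ne gW (hPle _ hw) h]
      exact zero_mem _
  have hvN : v ∈ ⨆ η, P η := by
    rw [← hN, hNtop]
    simp
  have hvP : gradedComponent gW δ v ∈ P δ := hmap hvN
  rw [gradedComponent_of_mem gW hv] at hvP
  exact hvP

end GradedLieModule


/-- **Lemma 3.2 (irreducibility of graded highest weight modules).**
Let `Γ` be an abelian group with an additive partial order, `L` a `Γ`-graded
complex Lie algebra, and `W` a `Γ`-graded `L`-module.  If `v` is a nonzero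
vector of degree `0` which generates `W`, is annihilated by `L_γ` for all
`γ ≻ 0`, spans `W_0`, if `W_γ = 0` unless `γ ⪯ 0`, and if the only graded
`L`-submodules of `W` are `0` and `W`, then the only `L`-submodules of `W`
are `0` and `W`, i.e. `W` is an irreducible `L`-module. -/
theorem statement3 {Γ : Type*} [AddCommGroup Γ] [PartialOrder Γ] [DecidableEq Γ]
    (hadd : ∀ a b c d : Γ, a ≤ b → c ≤ d → a + c ≤ b + d)
    {L : Type*} [LieRing L] [LieAlgebra ℂ L]
    {W : Type*} [AddCommGroup W] [Module ℂ W] [LieRingModule L W] [LieModule ℂ L W]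
    -- the `Γ`-grading of the Lie algebra `L`
    (gL : Γ → Submodule ℂ L)
    (hgL : DirectSum.IsInternal gL)
    (hgLbracket : ∀ γ δ : Γ, ∀ x ∈ gL γ, ∀ y ∈ gL δ, ⁅x, y⁆ ∈ gL (γ + δ))
    -- the `Γ`-grading of the `L`-module `W`
    (gW : Γ → Submodule ℂ W)
    (hgW : DirectSum.IsInternal gW)
    (hgWaction : ∀ γ δ : Γ, ∀ x ∈ gL γ, ∀ w ∈ gW δ, ⁅x, w⁆ ∈ gW (γ + δ))
    -- the highest weight vector `v`
    (v : W) (hv_ne : v ≠ 0) (hv_mem : v ∈ gW (0 : Γ))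
    -- (i) `W` is generated by `v` as an `L`-module
    (hgen : LieSubmodule.lieSpan ℂ L {v} = ⊤)
    -- (ii) `L_γ · v = 0` for every `γ ≻ 0`
    (hhw : ∀ γ : Γ, 0 < γ → ∀ x ∈ gL γ, ⁅x, v⁆ = 0)
    -- (iii) `W_0 = ℂ v`
    (hW0 : gW (0 : Γ) = Submodule.span ℂ {v})
    -- (iv) `W_γ = 0` unless `γ ⪯ 0`
    (hWneg : ∀ γ : Γ, ¬ γ ≤ 0 → gW γ = ⊥)
    -- (v) the only graded `L`-submodules of `W` are `0` and `W`
    (hgraded : ∀ U : LieSubmodule ℂ L W,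
      (U : Submodule ℂ W) = ⨆ γ : Γ, (U : Submodule ℂ W) ⊓ gW γ → U = ⊥ ∨ U = ⊤) :
    ∀ U : LieSubmodule ℂ L W, U = ⊥ ∨ U = ⊤ := by
  intro U
  refine or_iff_not_imp_left.2 fun hU => ?_
  let _ := hgW.chooseDecomposition
  obtain ⟨u, hu, hu0⟩ := (U : Submodule ℂ W).ne_bot_iff.1
    (mt (LieSubmodule.toSubmodule_eq_bot U).1 hU)
  obtain ⟨γ, hγ, hmin⟩ := exists_minimal_gradedComponent_ne_zero gW hu0
  obtain ⟨w, hw, hwv⟩ := exists_mem_shiftedSupport gW hgL.submodule_iSup_eq_top hgWaction hgraded U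
    hu hγ hv_mem
  rw [mem_shiftedSupport] at hw
  have hvw : w = v := by
    refine (eq_gradedComponent_of_forall_ne gW fun ε hε => ?_).trans hwv
    by_contra hne
    have hε0 : ε ≤ 0 := by
      by_contra h
      have hmem := gradedComponent_mem gW ε w
      rw [hWneg ε h] at hmem
      exact hne (by simpa using hmem)
    have hle : ε - (0 - γ) ≤ γ := by simpa using hadd ε 0 γ γ hε0 le_rfl
    have hge := hmin (fun h => hne (hw.2 ε h)) hle
    exact hε (by simpa using le_antisymm hle hge)
  rw [eq_top_iff, ← hgen, LieSubmodule.lieSpan_le, Set.singleton_subset_iff]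
  exact hvw ▸ hw.1
end

section
/- For 1 ≤ i, j ≤ m and a, b ∈ ℤ let T_{i,j}(a,b) be the operator Σ_{k=1}^{n} Σ_{r∈S} q^{−br} :psi_i^k(a−r) psibar_j^k(r): on F_N(S), and for 1 ≤ i, j ≤ m and c, d ∈ S let S_{i,j}(c,d) be the operator Σ_{k=1}^{n} psi_i^k(c) psibar_j^k(d) on F_N(S). Then: (1) a ℂ-subspace U of F_N(S) is invariant under all the operators T_{i,j}(a,b) if and only if it is invariant under all the operators S_{i,j}(c,d); (2) if U and U' are subspaces invariant under all these operators and f : U → U' is ℂ-linear, then f intertwines all the operators T_{i,j}(a,b) (i.e. f(T_{i,j}(a,b)x) = T_{i,j}(a,b)f(x) for all x ∈ U) if and only if f intertwines all the operators S_{i,j}(c,d). -/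
noncomputable section

/-- Context for the enlarged Weyl algebra `W_N(S)` with `N = m·n` and
`S = ℤ` (encoded by `sig = 0`) or `S = ℤ + 1/2` (encoded by `sig = 1`).
An element `r ∈ S` is encoded by the unique integer `k` with `r = k + sig/2`,
so that `ε := 1/2 - sig/2` and e.g. `r > 0 ↔ 0 < 2k + sig`.
The data also fixes a generic `q ∈ ℂˣ` together with a square root `sq` of `q`. -/
structure WCtx where
  m : ℕ
  n : ℕ
  hm : 0 < m
  hn : 0 < n
  sig : ℤ
  hsig : sig = 0 ∨ sig = 1
  q : ℂ
  sq : ℂ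
  hsq : sq ^ 2 = q
  hq0 : q ≠ 0
  hqu : ∀ k : ℕ, k ≠ 0 → q ^ k ≠ 1

namespace WCtx

variable (C : WCtx)

/-- `N = m n`. -/
def NN : ℕ := C.m * C.n

/-- Names of the generators of `W_N(S)`: `Sum.inl i` is `ψ_{i+1}` and
`Sum.inr i` is `ψ̄_{i+1}`; the integer `k` encodes the index `r = k + sig/2 ∈ S`. -/
abbrev Gen : Type := (Fin C.NN ⊕ Fin C.NN) × ℤ

/-- The defining relations of the enlarged Weyl algebra `W_N(S)`:
any two `ψ`'s commute, any two `ψ̄`'s commute, and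
`ψ̄_i(k)ψ_j(r) − ψ_j(r)ψ̄_i(k) = δ_{i,j} δ_{k+r,0}`. -/
inductive rel : FreeAlgebra ℂ C.Gen → FreeAlgebra ℂ C.Gen → Prop
  | comm_psi (i j : Fin C.NN) (k l : ℤ) :
      rel (FreeAlgebra.ι ℂ ((Sum.inl i, k) : C.Gen) * FreeAlgebra.ι ℂ ((Sum.inl j, l) : C.Gen))
          (FreeAlgebra.ι ℂ ((Sum.inl j, l) : C.Gen) * FreeAlgebra.ι ℂ ((Sum.inl i, k) : C.Gen))
  | comm_psibar (i j : Fin C.NN) (k l : ℤ) :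
      rel (FreeAlgebra.ι ℂ ((Sum.inr i, k) : C.Gen) * FreeAlgebra.ι ℂ ((Sum.inr j, l) : C.Gen))
          (FreeAlgebra.ι ℂ ((Sum.inr j, l) : C.Gen) * FreeAlgebra.ι ℂ ((Sum.inr i, k) : C.Gen))
  | mixed (i j : Fin C.NN) (k l : ℤ) :
      rel (FreeAlgebra.ι ℂ ((Sum.inr i, k) : C.Gen) * FreeAlgebra.ι ℂ ((Sum.inl j, l) : C.Gen))
          (FreeAlgebra.ι ℂ ((Sum.inl j, l) : C.Gen) * FreeAlgebra.ι ℂ ((Sum.inr i, k) : C.Gen)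
            + (if i = j ∧ k + l + C.sig = 0 then 1 else 0))

/-- The enlarged Weyl algebra `W_N(S)`. -/
def W : Type := RingQuot C.rel

instance : Ring C.W := inferInstanceAs (Ring (RingQuot C.rel))
instance : Algebra ℂ C.W := inferInstanceAs (Algebra ℂ (RingQuot C.rel))

/-- `ψ` with `0`-indexed flat subscript. -/
def psi0 (i : Fin C.NN) (k : ℤ) : C.W :=
  RingQuot.mkAlgHom ℂ C.rel (FreeAlgebra.ι ℂ ((Sum.inl i, k) : C.Gen))

/-- `ψ̄` with `0`-indexed flat subscript. -/
def psibar0 (i : Fin C.NN) (k : ℤ) : C.W :=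
  RingQuot.mkAlgHom ℂ C.rel (FreeAlgebra.ι ℂ ((Sum.inr i, k) : C.Gen))

/-- `ψ_i(r)` with `1`-indexed flat subscript `i ∈ {1,…,N}` (junk value `0` outside). -/
def psiF (i : ℕ) (k : ℤ) : C.W :=
  if h : 1 ≤ i ∧ i ≤ C.NN then C.psi0 ⟨i - 1, by omega⟩ k else 0

/-- `ψ̄_i(r)` with `1`-indexed flat subscript `i ∈ {1,…,N}` (junk value `0` outside). -/
def psibarF (i : ℕ) (k : ℤ) : C.W :=
  if h : 1 ≤ i ∧ i ≤ C.NN then C.psibar0 ⟨i - 1, by omega⟩ k else 0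

/-- `ψ_i^c(r) = ψ_{i+(c-1)m}(r)`, subscript `i ∈ {1,…,m}`, superscript `c ∈ {1,…,n}`. -/
def psiS (i c : ℕ) (k : ℤ) : C.W := C.psiF (i + (c - 1) * C.m) k

/-- `ψ̄_i^c(r) = ψ̄_{i+(c-1)m}(r)`. -/
def psibarS (i c : ℕ) (k : ℤ) : C.W := C.psibarF (i + (c - 1) * C.m) k

/-- The left ideal of `W_N(S)` generated by all `ψ_i(r), ψ̄_i(r)` with `r > 0`,
together with all `ψ̄_i(0)` when `S = ℤ`. -/
def vacIdeal : Submodule C.W C.W :=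
  Submodule.span C.W
    {w : C.W |
      (∃ (i : Fin C.NN) (k : ℤ), 0 < 2 * k + C.sig ∧ (w = C.psi0 i k ∨ w = C.psibar0 i k)) ∨
        (C.sig = 0 ∧ ∃ i : Fin C.NN, w = C.psibar0 i 0)}

/-- The Fock module `F_N(S) = W_N(S)/I`. -/
def F : Type := C.W ⧸ C.vacIdeal

instance : AddCommGroup C.F := inferInstanceAs (AddCommGroup (C.W ⧸ C.vacIdeal))
instance : Module C.W C.F := inferInstanceAs (Module C.W (C.W ⧸ C.vacIdeal))
instance : Module ℂ C.F := inferInstanceAs (Module ℂ (C.W ⧸ C.vacIdeal))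

/-- The vacuum vector `|0⟩ ∈ F_N(S)`. -/
def vac : C.F := Submodule.Quotient.mk (1 : C.W)

/-- Normal ordering `:u(k) v(l):` where `l` encodes the `S`-index of the second factor. -/
def nord (u : C.W) (l : ℤ) (v : C.W) : C.W :=
  if 0 < 2 * l + C.sig then u * v
  else if 2 * l + C.sig = 0 then (2 : ℂ)⁻¹ • (u * v + v * u)
  else v * u

/-- `ε = 0` if `S = ℤ + 1/2`, `ε = 1/2` if `S = ℤ`, as a complex number. -/
def eps : ℂ := (1 - (C.sig : ℂ)) / 2

/-- `ω_S(b)`. -/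
def om (b : ℤ) : ℂ :=
  if b = 0 then 0
  else if C.sig = 0 then (2 : ℂ)⁻¹ * ((C.q ^ b + 1) / (C.q ^ b - 1))
  else C.sq ^ b / (C.q ^ b - 1)

/-- `q^{-b r}` for `r = k + sig/2 ∈ S`. -/
def qp (b k : ℤ) : ℂ := C.sq ^ (-(b * (2 * k + C.sig)))

/-- `q^{b r}` for `r = k + sig/2 ∈ S`. -/
def qpp (b k : ℤ) : ℂ := C.sq ^ (b * (2 * k + C.sig))

/-- `φ^c_{t + sig/2}`; here `t ∈ ℤ` encodes the half-integer index `t + sig/2 = t + 1/2 - ε`.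
Writing `t = (k + sig)m - i` with `1 ≤ i ≤ m`, `k ∈ ℤ`, this is `ψ_i^c(k + sig/2)`. -/
def PhiW (c : ℕ) (t : ℤ) : C.W :=
  C.psiF ((((-t - 1).emod C.m).toNat + 1) + (c - 1) * C.m)
    ((t + (-t - 1).emod C.m + 1) / C.m - C.sig)

/-- `φ̄^c_{t + sig/2}`; writing `t = k·m + i - 1` with `1 ≤ i ≤ m`, `k ∈ ℤ`,
this is `ψ̄_i^c(k + sig/2)`. -/
def PhibarW (c : ℕ) (t : ℤ) : C.W :=
  C.psibarF (((t.emod C.m).toNat + 1) + (c - 1) * C.m) ((t - t.emod C.m) / C.m)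

/-- Determinant of a square matrix with (pairwise commuting) entries in `W_N(S)`. -/
def ncdet {l : ℕ} (M : Fin l → Fin l → C.W) : C.W :=
  ∑ p : Equiv.Perm (Fin l),
    (((Equiv.Perm.sign p : ℤˣ) : ℤ)) • ((List.finRange l).map fun t => M (p t) t).prod

/-- The element `A_l ∈ W_N(S)`, `1 ≤ l ≤ n`. -/
def Adet (l : ℕ) : C.W :=
  C.ncdet fun k t : Fin l => C.PhiW ((k : ℕ) + 1) (-(((t : ℕ) : ℤ) + 1))

/-- The element `Ā_l ∈ W_N(S)`, `1 ≤ l ≤ n`. -/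
def Abar (l : ℕ) : C.W :=
  C.ncdet fun s t : Fin (C.n - l + 1) => C.PhibarW (C.n - (s : ℕ)) (-(((t : ℕ) : ℤ) + 1))

/-- `α(r,a,i) = (a - r + 1/2 - ε)m - i + 1 = (a-k)m - i + 1` for `r = k + sig/2`. -/
def alphaV (k a : ℤ) (i : ℕ) : ℤ := (a - k) * C.m - (i : ℤ) + 1

/-- `β(r,a,j) = (r + a - 1/2 + ε)m + j = (k+a)m + j` for `r = k + sig/2`. -/
def betaV (k a : ℤ) (j : ℕ) : ℤ := (k + a) * C.m + (j : ℤ)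

/-- `Σ_{c=1}^{n} ψ_i^c(a-r) ψ̄_j^c(r)`, where `k` encodes `r`. -/
def Esum (i j : ℕ) (a k : ℤ) : C.W :=
  ∑ c : Fin C.n, C.psiS i ((c : ℕ) + 1) (a - k - C.sig) * C.psibarS j ((c : ℕ) + 1) k

/-- `A_l^{i,j,r}`: `A_l` with the `β(r,0,j)`-th column replaced by
`(φ^1_{α(r,a,i)-1/2-ε}, …, φ^l_{α(r,a,i)-1/2-ε})ᵗ`. -/
def Amod (l : ℕ) (i j : ℕ) (a k : ℤ) : C.W :=
  C.ncdet fun r t : Fin l =>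
    if (((t : ℕ) : ℤ) + 1) = C.betaV k 0 j then C.PhiW ((r : ℕ) + 1) (C.alphaV k a i - 1)
    else C.PhiW ((r : ℕ) + 1) (-(((t : ℕ) : ℤ) + 1))

/-- `Ā_l^{i,j,r}`: `Ā_l` with the `α(r,a,i)`-th column replaced by
`(-φ̄^n_{β(r,0,j)-1/2-ε}, …, -φ̄^l_{β(r,0,j)-1/2-ε})ᵗ`. -/
def Abarmod (l : ℕ) (i j : ℕ) (a k : ℤ) : C.W :=
  C.ncdet fun s t : Fin (C.n - l + 1) =>
    if (((t : ℕ) : ℤ) + 1) = C.alphaV k a i then -C.PhibarW (C.n - (s : ℕ)) (C.betaV k 0 j - 1)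
    else C.PhibarW (C.n - (s : ℕ)) (-(((t : ℕ) : ℤ) + 1))

/-- `l̄₁` for `l = l₁ m + l₂`, `1 ≤ l₂ ≤ m`. -/
def lb1 (l : ℕ) : ℕ :=
  if (l - 1) / C.m % 2 = 0 then ((l - 1) / C.m / 2) * C.m + ((l - 1) % C.m + 1)
  else (((l - 1) / C.m + 1) / 2) * C.m

/-- `l̄₂ = l - l̄₁`. -/
def lb2 (l : ℕ) : ℕ := l - C.lb1 l

/-- The `(k,t)` entry of the matrix defining `B_l`. -/
def Bentry (l : ℕ) (k t : Fin l) : C.W :=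
  if (t : ℕ) + 1 ≤ C.lb1 l then C.PhiW ((k : ℕ) + 1) (-(((t : ℕ) : ℤ) + 1))
  else C.PhibarW (C.n - (k : ℕ)) (-((((t : ℕ) : ℤ) + 1) - (C.lb1 l : ℤ)))

/-- The element `B_l ∈ W_N(S)`, `1 ≤ l ≤ n`. -/
def Bdet (l : ℕ) : C.W := C.ncdet (C.Bentry l)

/-- The element `B̄_{n/2} ∈ W_N(S)` (`n` even): `B_{n/2}` with its `(n/2)`-th row replaced. -/
def Bbar : C.W :=
  C.ncdet fun k t : Fin (C.n / 2) =>
    if (k : ℕ) + 1 = C.n / 2 then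
      (if (t : ℕ) + 1 ≤ C.lb1 (C.n / 2) then C.PhiW (C.n / 2 + 1) (-(((t : ℕ) : ℤ) + 1))
       else C.PhibarW (C.n / 2) (-((((t : ℕ) : ℤ) + 1) - (C.lb1 (C.n / 2) : ℤ))))
    else C.Bentry (C.n / 2) k t

/-- `B_l` with its `pos`-th column replaced by the column `(col 1, …, col l)ᵗ`. -/
def Bcolrep (l : ℕ) (pos : ℤ) (col : ℕ → C.W) : C.W :=
  C.ncdet fun k t : Fin l =>
    if (((t : ℕ) : ℤ) + 1) = pos then col ((k : ℕ) + 1) else C.Bentry l k t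

/-- The operator `T_{i,j}(a,b) = Σ_{r∈S} q^{-br} Σ_{c=1}^n :ψ_i^c(a-r) ψ̄_j^c(r):`. -/
def Top (i j : ℕ) (a b : ℤ) (x : C.F) : C.F :=
  ∑ᶠ k : ℤ, (C.qp b k • ∑ c : Fin C.n,
    C.nord (C.psiS i ((c : ℕ) + 1) (a - k - C.sig)) k (C.psibarS j ((c : ℕ) + 1) k)) • x

/-- The operator `S_{i,j}(c,d) = Σ_{e=1}^n ψ_i^e(c) ψ̄_j^e(d)`. -/
def Sop (i j : ℕ) (c d : ℤ) (x : C.F) : C.F :=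
  (∑ e : Fin C.n, C.psiS i ((e : ℕ) + 1) c * C.psibarS j ((e : ℕ) + 1) d) • x

/-- The operator `E_{p,p} = Σ_{c=1}^m Σ_{r∈S} :ψ_c^p(-r) ψ̄_c^p(r): − ε m`. -/
def Epp (p : ℕ) (x : C.F) : C.F :=
  (∑ᶠ k : ℤ, (∑ c : Fin C.m,
      C.nord (C.psiS ((c : ℕ) + 1) p (-k - C.sig)) k (C.psibarS ((c : ℕ) + 1) p k)) • x)
    - (C.eps * (C.m : ℂ)) • x

/-- The operator `E_i(b) = Σ_{r∈S} q^{-br} Σ_{c=1}^n :ψ_i^c(-r) ψ̄_i^c(r): − n ω_S(b)`. -/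
def Eib (i : ℕ) (b : ℤ) (x : C.F) : C.F :=
  (∑ᶠ k : ℤ, (C.qp b k • ∑ c : Fin C.n,
      C.nord (C.psiS i ((c : ℕ) + 1) (-k - C.sig)) k (C.psibarS i ((c : ℕ) + 1) k)) • x)
    - ((C.n : ℂ) * C.om b) • x

/-- `Σ_{r ∈ J^S_{i,l}} q^{-br}`. -/
def Jsum (i l : ℕ) (b : ℤ) : ℂ :=
  ∑ᶠ k ∈ {k : ℤ | 1 ≤ k * (C.m : ℤ) + (i : ℤ) ∧ k * (C.m : ℤ) + (i : ℤ) ≤ (l : ℤ)}, C.qp b k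

/-- `Σ_{r ∈ J̄^S_{i,l}} q^{-br}`. -/
def Jbarsum (i l : ℕ) (b : ℤ) : ℂ :=
  ∑ᶠ k ∈ {k : ℤ | 1 ≤ -(k * (C.m : ℤ)) - (i : ℤ) + 1 ∧ -(k * (C.m : ℤ)) - (i : ℤ) + 1 ≤ (l : ℤ)},
    C.qp b k

/-- `Σ_{r ∈ J^S_{i,l}} q^{br}`. -/
def JsumP (i l : ℕ) (b : ℤ) : ℂ :=
  ∑ᶠ k ∈ {k : ℤ | 1 ≤ k * (C.m : ℤ) + (i : ℤ) ∧ k * (C.m : ℤ) + (i : ℤ) ≤ (l : ℤ)}, C.qpp b k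

/-- `Σ_{c=1}^m ψ_c^p(-r) ψ̄_c^{p+1}(r)` (no normal ordering), `k` encoding `r ∈ S`. -/
def glRaise (p : ℕ) (k : ℤ) : C.W :=
  ∑ c : Fin C.m, C.psiS ((c : ℕ) + 1) p (-k - C.sig) * C.psibarS ((c : ℕ) + 1) (p + 1) k

/-- The operator `Σ_{c=1}^m Σ_{r∈S} :ψ_c^p(-r) ψ̄_c^{p+1}(r):`. -/
def glRaiseOp (p : ℕ) (x : C.F) : C.F :=
  ∑ᶠ k : ℤ, (∑ c : Fin C.m,
    C.nord (C.psiS ((c : ℕ) + 1) p (-k - C.sig)) k (C.psibarS ((c : ℕ) + 1) (p + 1) k)) • x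

end WCtx

namespace WCtx

variable (C : WCtx)

instance : IsScalarTower ℂ C.W C.F :=
  inferInstanceAs (IsScalarTower ℂ C.W (C.W ⧸ C.vacIdeal))

/-- The projection from the free algebra onto `W_N(S)`. -/
def toW : FreeAlgebra ℂ C.Gen →ₐ[ℂ] C.W :=
  RingQuot.mkAlgHom ℂ C.rel

lemma toW_surjective : Function.Surjective C.toW :=
  RingQuot.mkAlgHom_surjective ℂ C.rel

/-- The generators of `W_N(S)`, as a single family. -/
def gen (g : Fin C.NN ⊕ Fin C.NN) (k : ℤ) : C.W :=
  C.toW (FreeAlgebra.ι ℂ ((g, k) : C.Gen))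

lemma psi0_comm (i j : Fin C.NN) (k l : ℤ) :
    C.psi0 i k * C.psi0 j l = C.psi0 j l * C.psi0 i k := by
  have h : C.toW _ = C.toW _ := RingQuot.mkAlgHom_rel ℂ (rel.comm_psi (C := C) i j k l)
  rw [map_mul, map_mul] at h
  exact h

lemma psibar0_comm (i j : Fin C.NN) (k l : ℤ) :
    C.psibar0 i k * C.psibar0 j l = C.psibar0 j l * C.psibar0 i k := by
  have h : C.toW _ = C.toW _ := RingQuot.mkAlgHom_rel ℂ (rel.comm_psibar (C := C) i j k l)
  rw [map_mul, map_mul] at h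
  exact h

lemma psibar0_mul_psi0 (i j : Fin C.NN) (k l : ℤ) :
    C.psibar0 i k * C.psi0 j l = C.psi0 j l * C.psibar0 i k
      + algebraMap ℂ C.W (if i = j ∧ k + l + C.sig = 0 then 1 else 0) := by
  have h : C.toW _ = C.toW _ := RingQuot.mkAlgHom_rel ℂ (rel.mixed (C := C) i j k l)
  rw [map_add, map_mul, map_mul, apply_ite C.toW, map_one, map_zero] at h
  rw [apply_ite (algebraMap ℂ C.W), map_one, map_zero]
  exact h

lemma gen_comm_of_add_ne_zero (g h : Fin C.NN ⊕ Fin C.NN) {k l : ℤ} (hkl : k + l + C.sig ≠ 0) :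
    C.gen g k * C.gen h l = C.gen h l * C.gen g k := by
  rcases g with i | i <;> rcases h with j | j
  · exact C.psi0_comm i j k l
  · have := C.psibar0_mul_psi0 j i l k
    rw [if_neg (by omega), map_zero, add_zero] at this
    exact this.symm
  · have := C.psibar0_mul_psi0 i j k l
    rw [if_neg (by omega), map_zero, add_zero] at this
    exact this
  · exact C.psibar0_comm i j k l

/-- Every generator of sufficiently large index annihilates `x`. -/
def EventuallyKilled (x : C.F) : Prop :=
  ∀ g : Fin C.NN ⊕ Fin C.NN, ∀ᶠ k in Filter.atTop, C.gen g k • x = 0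

variable {C}

lemma EventuallyKilled.gen_smul {x : C.F} (hx : C.EventuallyKilled x)
    (h : Fin C.NN ⊕ Fin C.NN) (l : ℤ) : C.EventuallyKilled (C.gen h l • x) := by
  intro g
  filter_upwards [hx g, Filter.eventually_gt_atTop (-l - C.sig)] with k hk hkl
  rw [← mul_smul, C.gen_comm_of_add_ne_zero g h (by omega), mul_smul, hk, smul_zero]

lemma EventuallyKilled.smul {x : C.F} (hx : C.EventuallyKilled x) (w : C.W) :
    C.EventuallyKilled (w • x) := by
  obtain ⟨a, rfl⟩ := C.toW_surjective w
  induction a using FreeAlgebra.induction generalizing x with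
  | grade0 r =>
    intro g
    filter_upwards [hx g] with k hk
    rw [AlgHom.commutes, ← mul_smul, ← Algebra.commutes, mul_smul, hk, smul_zero]
  | grade1 g => exact hx.gen_smul g.1 g.2
  | mul a b ha hb =>
    rw [map_mul, mul_smul]
    exact ha (hb hx)
  | add a b ha hb =>
    intro g
    filter_upwards [ha hx g, hb hx g] with k h1 h2
    rw [map_add, add_smul, smul_add, h1, h2, add_zero]

variable (C)

lemma eventuallyKilled_vac : C.EventuallyKilled C.vac := by
  intro g
  filter_upwards [Filter.eventually_gt_atTop 0] with k hk
  have hpos : 0 < 2 * k + C.sig := by rcases C.hsig with h | h <;> omega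
  have hmem : C.gen g k * 1 ∈ C.vacIdeal := by
    rw [mul_one]
    refine Submodule.subset_span (Or.inl ?_)
    rcases g with i | i
    · exact ⟨i, k, hpos, Or.inl rfl⟩
    · exact ⟨i, k, hpos, Or.inr rfl⟩
  exact (Submodule.Quotient.mk_eq_zero C.vacIdeal).2 hmem

lemma eventuallyKilled (x : C.F) : C.EventuallyKilled x := by
  obtain ⟨w, rfl⟩ := Submodule.Quotient.mk_surjective C.vacIdeal x
  have e : (Submodule.Quotient.mk w : C.W ⧸ C.vacIdeal)
      = w • (Submodule.Quotient.mk 1 : C.W ⧸ C.vacIdeal) := by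
    rw [← Submodule.Quotient.mk_smul, smul_eq_mul, mul_one]
  rw [e]
  exact C.eventuallyKilled_vac.smul w

lemma eventually_psiS_smul (i c : ℕ) (x : C.F) :
    ∀ᶠ k in Filter.atTop, C.psiS i c k • x = 0 := by
  unfold psiS psiF
  split_ifs with h
  · exact C.eventuallyKilled x (Sum.inl _)
  · simp

lemma eventually_psibarS_smul (i c : ℕ) (x : C.F) :
    ∀ᶠ k in Filter.atTop, C.psibarS i c k • x = 0 := by
  unfold psibarS psibarF
  split_ifs with h
  · exact C.eventuallyKilled x (Sum.inr _)
  · simp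

/-- The `k`-th mode `Σ_c :ψ_i^c(a-r) ψ̄_j^c(r):` of `T_{i,j}(a,b)`, where `k` encodes `r`. -/
def mode (i j : ℕ) (a k : ℤ) : C.W :=
  ∑ c : Fin C.n,
    C.nord (C.psiS i ((c : ℕ) + 1) (a - k - C.sig)) k (C.psibarS j ((c : ℕ) + 1) k)

lemma finite_mode_smul_ne_zero (i j : ℕ) (a : ℤ) (x : C.F) :
    {k : ℤ | C.mode i j a k • x ≠ 0}.Finite := by
  suffices h : ∀ᶠ k in Filter.cofinite, C.mode i j a k • x = 0 from h
  rw [Int.cofinite_eq, Filter.eventually_sup]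
  constructor
  · have hpsi : ∀ᶠ k : ℤ in Filter.atBot, ∀ c : Fin C.n,
        C.psiS i ((c : ℕ) + 1) (a - k - C.sig) • x = 0 := by
      rw [Filter.eventually_all]
      intro c
      have ht : Filter.Tendsto (fun k : ℤ => a - k - C.sig) Filter.atBot Filter.atTop := by
        refine Filter.tendsto_atTop.2 fun M => ?_
        filter_upwards [Filter.eventually_le_atBot (a - C.sig - M)] with k hk
        omega
      exact ht.eventually (C.eventually_psiS_smul i _ x)
    filter_upwards [hpsi, Filter.eventually_lt_atBot (-1)] with k hk hneg
    have hs : 2 * k + C.sig < 0 := by rcases C.hsig with h | h <;> omega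
    rw [mode, Finset.sum_smul]
    refine Finset.sum_eq_zero fun c _ => ?_
    rw [nord, if_neg (by omega), if_neg (by omega), mul_smul, hk c, smul_zero]
  · have hpsibar : ∀ᶠ k : ℤ in Filter.atTop, ∀ c : Fin C.n,
        C.psibarS j ((c : ℕ) + 1) k • x = 0 :=
      Filter.eventually_all.2 fun c => C.eventually_psibarS_smul j _ x
    filter_upwards [hpsibar, Filter.eventually_gt_atTop 0] with k hk hpos
    have hs : 0 < 2 * k + C.sig := by rcases C.hsig with h | h <;> omega
    rw [mode, Finset.sum_smul]
    refine Finset.sum_eq_zero fun c _ => ?_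
    rw [nord, if_pos hs, mul_smul, hk c, smul_zero]

lemma exists_psibarS_mul_psiS (i j c : ℕ) (k l : ℤ) :
    ∃ z : ℂ, C.psibarS j c k * C.psiS i c l
      = C.psiS i c l * C.psibarS j c k + algebraMap ℂ C.W z := by
  unfold psibarS psiS psibarF psiF
  split_ifs
  · exact ⟨_, C.psibar0_mul_psi0 _ _ k l⟩
  all_goals exact ⟨0, by simp⟩

lemma exists_nord_eq {u v : C.W} (k : ℤ) (h : ∃ z : ℂ, v * u = u * v + algebraMap ℂ C.W z) :
    ∃ z : ℂ, C.nord u k v = u * v + algebraMap ℂ C.W z := by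
  obtain ⟨z, hz⟩ := h
  unfold nord
  split_ifs
  · exact ⟨0, by simp⟩
  · refine ⟨2⁻¹ * z, ?_⟩
    rw [hz, ← add_assoc, ← two_smul ℂ (u * v), smul_add, smul_smul,
      inv_mul_cancel₀ two_ne_zero, one_smul, map_mul, Algebra.smul_def]
  · exact ⟨z, hz⟩

/-- A mode of `T_{i,j}(a,b)` differs from the corresponding `S_{i,j}` by a scalar. -/
lemma exists_mode_smul_eq (i j : ℕ) (a k : ℤ) :
    ∃ z : ℂ, ∀ x : C.F, C.mode i j a k • x = C.Sop i j (a - k - C.sig) k x + z • x := by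
  choose z hz using fun c : Fin C.n =>
    C.exists_nord_eq k (C.exists_psibarS_mul_psiS i j ((c : ℕ) + 1) k (a - k - C.sig))
  refine ⟨∑ c, z c, fun x => ?_⟩
  rw [mode, Sop, Finset.sum_congr rfl fun c _ => hz c, Finset.sum_add_distrib, add_smul,
    ← map_sum, algebraMap_smul]

lemma Top_eq_finsum (i j : ℕ) (a b : ℤ) (x : C.F) :
    C.Top i j a b x = ∑ᶠ k : ℤ, C.qp b k • (C.mode i j a k • x) :=
  finsum_congr fun k => smul_assoc (C.qp b k) (C.mode i j a k) x

lemma sq_ne_zero : C.sq ≠ 0 := by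
  intro h
  apply C.hq0
  rw [← C.hsq, h]
  norm_num

lemma sq_zpow_injective : Function.Injective fun k : ℤ => C.sq ^ (-(2 * k + C.sig)) := by
  intro k l hkl
  by_contra hne
  have key : ∀ d : ℤ, d ≠ 0 → C.q ^ d ≠ 1 := by
    intro d hd h
    apply C.hqu d.natAbs (by omega)
    rcases Int.natAbs_eq d with e | e
    · rw [e, zpow_natCast] at h
      exact h
    · rw [e, zpow_neg, zpow_natCast, inv_eq_one] at h
      exact h
  apply key (l - k) (by omega)
  have hdiv : C.sq ^ (-(2 * k + C.sig)) / C.sq ^ (-(2 * l + C.sig)) = 1 := by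
    rw [div_eq_one_iff_eq (zpow_ne_zero _ C.sq_ne_zero)]
    exact hkl
  rw [← zpow_sub₀ C.sq_ne_zero] at hdiv
  rw [← C.hsq, ← zpow_natCast, ← zpow_mul, ← hdiv]
  congr 1
  push_cast
  ring

lemma qp_natCast (b : ℕ) (k : ℤ) : C.qp b k = (C.sq ^ (-(2 * k + C.sig))) ^ b := by
  rw [qp, ← zpow_natCast, ← zpow_mul]
  congr 1
  ring

/-- A mode is recovered from the `T_{i,j}(a,b)`, with coefficients that depend only on a finite
set outside which the modes vanish. -/
lemma exists_mode_smul_eq_sum_Top (i j : ℕ) (a k : ℤ) (s : Finset ℤ) :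
    ∃ p : Polynomial ℂ, ∀ x : C.F, (∀ l, C.mode i j a l • x ≠ 0 → l ∈ s) →
      C.mode i j a k • x
        = ∑ b ∈ Finset.range (p.natDegree + 1), p.coeff b • C.Top i j a b x := by
  classical
  set v : ℤ → ℂ := fun k => C.sq ^ (-(2 * k + C.sig)) with hv
  have hinj : Set.InjOn v (insert k s : Finset ℤ) := C.sq_zpow_injective.injOn
  refine ⟨Lagrange.basis (insert k s) v k, fun x hx => ?_⟩
  set p := Lagrange.basis (insert k s) v k with hp
  have hT : ∀ b : ℕ, C.Top i j a b x = ∑ l ∈ insert k s, v l ^ b • (C.mode i j a l • x) := by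
    intro b
    rw [Top_eq_finsum, finsum_eq_sum_of_support_subset _ (s := insert k s)]
    · exact Finset.sum_congr rfl fun l _ => by rw [qp_natCast]
    · intro l hl
      rw [Finset.mem_coe]
      refine Finset.mem_insert_of_mem (hx l fun h0 => hl ?_)
      simp only [h0, smul_zero]
  simp only [hT, Finset.smul_sum, smul_smul]
  rw [Finset.sum_comm]
  simp only [← Finset.sum_smul, ← Polynomial.eval_eq_sum_range]
  rw [Finset.sum_eq_single_of_mem k (Finset.mem_insert_self k s), hp,
    Lagrange.eval_basis_self hinj (Finset.mem_insert_self k s), one_smul]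
  intro l hl hlk
  rw [hp, Lagrange.eval_basis_of_ne hlk.symm hl, zero_smul]

/-- A subspace of `F_N(S) × F_N(S)` is invariant under the diagonal action of the `T_{i,j}(a,b)`
if and only if it is invariant under the diagonal action of the `S_{i,j}(c,d)`. -/
lemma prod_Top_invariant_iff_Sop_invariant (i j : ℕ) (G : Submodule ℂ (C.F × C.F)) :
    (∀ a b : ℤ, ∀ z ∈ G, (C.Top i j a b z.1, C.Top i j a b z.2) ∈ G) ↔
      (∀ c d : ℤ, ∀ z ∈ G, (C.Sop i j c d z.1, C.Sop i j c d z.2) ∈ G) := by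
  constructor
  · intro h c d z hz
    obtain ⟨w, hw⟩ := C.exists_mode_smul_eq i j (c + d + C.sig) d
    rw [show c + d + C.sig - d - C.sig = c by ring] at hw
    have h1 := C.finite_mode_smul_ne_zero i j (c + d + C.sig) z.1
    have h2 := C.finite_mode_smul_ne_zero i j (c + d + C.sig) z.2
    obtain ⟨p, hp⟩ :=
      C.exists_mode_smul_eq_sum_Top i j (c + d + C.sig) d (h1.union h2).toFinset
    have hmode : (C.mode i j (c + d + C.sig) d • z.1, C.mode i j (c + d + C.sig) d • z.2) ∈ G := by
      rw [hp z.1 fun l hl => (Set.Finite.mem_toFinset _).2 (Or.inl hl),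
        hp z.2 fun l hl => (Set.Finite.mem_toFinset _).2 (Or.inr hl), prod_mk_sum]
      exact G.sum_mem fun b _ => G.smul_mem (p.coeff b) (h _ b z hz)
    have hsub := G.sub_mem hmode (G.smul_mem w hz)
    rw [hw, hw] at hsub
    convert hsub using 1
    ext <;> simp
  · intro h a b z hz
    have h1 := C.finite_mode_smul_ne_zero i j a z.1
    have h2 := C.finite_mode_smul_ne_zero i j a z.2
    have hT : ∀ x : C.F, (∀ l, C.mode i j a l • x ≠ 0 → l ∈ (h1.union h2).toFinset) →
        C.Top i j a b x = ∑ l ∈ (h1.union h2).toFinset, C.qp b l • (C.mode i j a l • x) := by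
      intro x hx
      rw [Top_eq_finsum, finsum_eq_sum_of_support_subset]
      intro l hl
      refine hx l fun h0 => hl ?_
      simp only [h0, smul_zero]
    rw [hT z.1 fun l hl => (Set.Finite.mem_toFinset _).2 (Or.inl hl),
      hT z.2 fun l hl => (Set.Finite.mem_toFinset _).2 (Or.inr hl), prod_mk_sum]
    refine G.sum_mem fun k _ => G.smul_mem (C.qp b k) (?_ : (_, _) ∈ G)
    obtain ⟨w, hw⟩ := C.exists_mode_smul_eq i j a k
    rw [hw, hw]
    exact G.add_mem (h _ k z hz) (G.smul_mem w hz)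

lemma Top_invariant_iff_Sop_invariant (i j : ℕ) (U : Submodule ℂ C.F) :
    (∀ a b : ℤ, ∀ x ∈ U, C.Top i j a b x ∈ U) ↔ (∀ c d : ℤ, ∀ x ∈ U, C.Sop i j c d x ∈ U) := by
  have h := C.prod_Top_invariant_iff_Sop_invariant i j (U.prod U)
  simp only [Submodule.mem_prod] at h
  constructor
  · intro hT c d x hx
    exact (h.1 (fun a b z hz => ⟨hT a b _ hz.1, hT a b _ hz.2⟩) c d (x, x) ⟨hx, hx⟩).1
  · intro hS a b x hx
    exact (h.2 (fun c d z hz => ⟨hS c d _ hz.1, hS c d _ hz.2⟩) a b (x, x) ⟨hx, hx⟩).1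

/-- The graph of a linear map between subspaces is invariant under the diagonal action of an
operator preserving the source if and only if the map intertwines the operator. -/
lemma graph_invariant_iff {U U' : Submodule ℂ C.F} (f : U →ₗ[ℂ] U') (T : C.F → C.F)
    (hT : ∀ x ∈ U, T x ∈ U) :
    (∀ z ∈ LinearMap.range (U.subtype.prod (U'.subtype ∘ₗ f)),
        (T z.1, T z.2) ∈ LinearMap.range (U.subtype.prod (U'.subtype ∘ₗ f))) ↔
      ∀ x : U, (f ⟨T x, hT x x.2⟩ : C.F) = T (f x : C.F) := by
  constructor
  · intro h x
    obtain ⟨y, hy⟩ := h _ ⟨x, rfl⟩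
    have hy1 : (y : C.F) = T x := congrArg Prod.fst hy
    have hy2 : (f y : C.F) = T (f x) := congrArg Prod.snd hy
    rw [← hy2]
    congr 2
    exact Subtype.ext hy1.symm
  · rintro h _ ⟨x, rfl⟩
    exact ⟨⟨T x, hT x x.2⟩, Prod.ext rfl (h x)⟩

end WCtx

open WCtx in
/-- **Lemma 5.2 for `(GL_n, ĝl_m(C_q))`.**  A subspace `U ⊆ F_N(S)` is invariant under
all the operators `T_{i,j}(a,b) = Σ_{c,r} q^{-br} :ψ_i^c(a-r)ψ̄_j^c(r):` iff it is
invariant under all the operators `S_{i,j}(c,d) = Σ_e ψ_i^e(c)ψ̄_j^e(d)`; and a linear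
map between two invariant subspaces intertwines the `T`'s iff it intertwines the `S`'s. -/
theorem statement5 (C : WCtx) :
    (∀ U : Submodule ℂ C.F,
      (∀ i j : ℕ, 1 ≤ i → i ≤ C.m → 1 ≤ j → j ≤ C.m → ∀ a b : ℤ,
          ∀ x ∈ U, C.Top i j a b x ∈ U)
        ↔ (∀ i j : ℕ, 1 ≤ i → i ≤ C.m → 1 ≤ j → j ≤ C.m → ∀ c d : ℤ,
          ∀ x ∈ U, C.Sop i j c d x ∈ U))
    ∧
    (∀ (U U' : Submodule ℂ C.F)
      (hUT : ∀ i j : ℕ, 1 ≤ i → i ≤ C.m → 1 ≤ j → j ≤ C.m → ∀ a b : ℤ,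
        ∀ x ∈ U, C.Top i j a b x ∈ U)
      (hUS : ∀ i j : ℕ, 1 ≤ i → i ≤ C.m → 1 ≤ j → j ≤ C.m → ∀ c d : ℤ,
        ∀ x ∈ U, C.Sop i j c d x ∈ U)
      (_hU'T : ∀ i j : ℕ, 1 ≤ i → i ≤ C.m → 1 ≤ j → j ≤ C.m → ∀ a b : ℤ,
        ∀ x ∈ U', C.Top i j a b x ∈ U')
      (_hU'S : ∀ i j : ℕ, 1 ≤ i → i ≤ C.m → 1 ≤ j → j ≤ C.m → ∀ c d : ℤ,
        ∀ x ∈ U', C.Sop i j c d x ∈ U')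
      (f : U →ₗ[ℂ] U'),
      (∀ (i j : ℕ) (hi : 1 ≤ i) (hi' : i ≤ C.m) (hj : 1 ≤ j) (hj' : j ≤ C.m)
          (a b : ℤ) (x : U),
          (f ⟨C.Top i j a b x, hUT i j hi hi' hj hj' a b x x.2⟩ : C.F)
            = C.Top i j a b (f x : C.F))
        ↔ (∀ (i j : ℕ) (hi : 1 ≤ i) (hi' : i ≤ C.m) (hj : 1 ≤ j) (hj' : j ≤ C.m)
          (c d : ℤ) (x : U),
          (f ⟨C.Sop i j c d x, hUS i j hi hi' hj hj' c d x x.2⟩ : C.F)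
            = C.Sop i j c d (f x : C.F))) := by
  refine ⟨fun U => ?_, fun U U' hUT hUS _ _ f => ?_⟩
  · exact forall₂_congr fun i j => forall₄_congr fun _ _ _ _ =>
      C.Top_invariant_iff_Sop_invariant i j U
  · refine forall₂_congr fun i j => forall₄_congr fun hi hi' hj hj' => ?_
    have h := C.prod_Top_invariant_iff_Sop_invariant i j
      (LinearMap.range (U.subtype.prod (U'.subtype ∘ₗ f)))
    rwa [forall₂_congr fun a b => C.graph_invariant_iff f _ (hUT i j hi hi' hj hj' a b),
      forall₂_congr fun c d => C.graph_invariant_iff f _ (hUS i j hi hi' hj hj' c d)] at h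
end
end

section
/- Let 1 ≤ i, j ≤ m, a ∈ ℤ, r ∈ S, 1 ≤ l ≤ n, and assume either a > 0, or a = 0 and i < j. If α(r,a,i) ∉ I_{n−l+1} then [Σ_{k=1}^{n} psi_i^k(a−r) psibar_j^k(r), Abar_l] = 0 in W_N(S). If α(r,a,i) ∈ I_{n−l+1} then [Σ_{k=1}^{n} psi_i^k(a−r) psibar_j^k(r), Abar_l] = Abar_l^{i,j,r}, where Abar_l^{i,j,r} is the determinant obtained from Abar_l by replacing its α(r,a,i)-th column by the column (−phibar^n_{β(r,0,j)−1/2−ε}, −phibar^{n−1}_{β(r,0,j)−1/2−ε}, …, −phibar^l_{β(r,0,j)−1/2−ε})^t; moreover, in this case [Abar_{l'}, Abar_l^{i,j,r}] = 0 for all l ≤ l' ≤ n, and Abar_l^{i,j,r}|0⟩ = 0 in F_N(S). -/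
noncomputable section

section ListProducts

variable {R ι : Type*} [Ring R] [DecidableEq ι]

/-- The commutator with `e` is a derivation; if it kills all factors but the one indexed by `t₀`,
the Leibniz rule has a single term. -/
theorem commutator_list_prod (e : R) (f g : ι → R) (t₀ : ι)
    (h₀ : e * f t₀ - f t₀ * e = g t₀)
    (h : ∀ t, t ≠ t₀ → e * f t - f t * e = 0) (hg : ∀ t, t ≠ t₀ → g t = f t) :
    ∀ L : List ι, L.Nodup →
      e * (L.map f).prod - (L.map f).prod * e = if t₀ ∈ L then (L.map g).prod else 0
  | [], _ => by simp
  | x :: L, hL => by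
    have hx := (List.nodup_cons.1 hL).1
    have ih := commutator_list_prod e f g t₀ h₀ h hg L (List.nodup_cons.1 hL).2
    have leibniz : e * (f x * (L.map f).prod) - f x * (L.map f).prod * e
        = (e * f x - f x * e) * (L.map f).prod
          + f x * (e * (L.map f).prod - (L.map f).prod * e) := by noncomm_ring
    rw [List.map_cons, List.map_cons, List.prod_cons, List.prod_cons, leibniz, ih]
    by_cases hxt : x = t₀
    · subst hxt
      have hmap : L.map g = L.map f :=
        List.map_congr_left fun t ht => hg t fun h' => hx (h' ▸ ht)
      simp [hx, h₀, hmap]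
    · have hxt' : ¬ t₀ = x := fun h' => hxt h'.symm
      by_cases ht : t₀ ∈ L <;> simp [ht, h x hxt, hg x hxt, hxt']

end ListProducts

theorem commutator_list_prod_eq_zero {R : Type*} [Ring R] (e : R) (L : List R)
    (h : ∀ x ∈ L, e * x - x * e = 0) : e * L.prod - L.prod * e = 0 :=
  sub_eq_zero.2 (Commute.list_prod_right L e fun x hx => sub_eq_zero.1 (h x hx))

theorem list_prod_smul_eq_zero {R M : Type*} [Ring R] [AddCommGroup M] [Module R M] (x : R) (v : M)
    (hv : x • v = 0) : ∀ L : List R, (∀ y ∈ L, Commute x y) → x ∈ L → L.prod • v = 0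
  | [], _, hx => by simp at hx
  | y :: L, hc, hx => by
    rw [List.prod_cons]
    rcases List.mem_cons.1 hx with rfl | hx
    · have hcomm : Commute x L.prod :=
        Commute.list_prod_right L x fun z hz => hc z (List.mem_cons_of_mem _ hz)
      rw [hcomm.eq, mul_smul, hv, smul_zero]
    · rw [mul_smul, list_prod_smul_eq_zero x v hv L
        (fun z hz => hc z (List.mem_cons_of_mem _ hz)) hx, smul_zero]

namespace WCtx

variable (C : WCtx)

theorem psibarF_commute (I J : ℕ) (k k' : ℤ) : Commute (C.psibarF I k) (C.psibarF J k') := by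
  unfold psibarF
  split_ifs with h h'
  · have := RingQuot.mkAlgHom_rel ℂ
      (rel.comm_psibar (C := C) ⟨I - 1, by omega⟩ ⟨J - 1, by omega⟩ k k')
    rw [map_mul, map_mul] at this
    exact this
  all_goals simp

theorem psibarF_mul_psiF (I J : ℕ) (k k' : ℤ) (hI : 1 ≤ I) (hI' : I ≤ C.NN) :
    C.psibarF I k * C.psiF J k' = C.psiF J k' * C.psibarF I k
      + if I = J ∧ k + k' + C.sig = 0 then 1 else 0 := by
  unfold psibarF psiF
  rw [dif_pos ⟨hI, hI'⟩]
  split_ifs with h h' h'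
  · have := RingQuot.mkAlgHom_rel ℂ (rel.mixed (C := C) ⟨I - 1, by omega⟩ ⟨J - 1, by omega⟩ k k')
    rw [if_pos ⟨by simp [h'.1], h'.2⟩] at this
    rw [map_add, map_mul, map_mul, map_one] at this
    exact this
  · have := RingQuot.mkAlgHom_rel ℂ (rel.mixed (C := C) ⟨I - 1, by omega⟩ ⟨J - 1, by omega⟩ k k')
    rw [if_neg (fun hh => h' ⟨by have := Fin.mk.inj_iff.1 hh.1; omega, hh.2⟩)] at this
    rw [map_add, map_mul, map_mul, map_zero] at this
    exact this
  · omega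
  · simp

theorem PhibarW_commute (c c' : ℕ) (t t' : ℤ) : Commute (C.PhibarW c t) (C.PhibarW c' t') :=
  C.psibarF_commute _ _ _ _

theorem PhibarW_mul_add (c i : ℕ) (k : ℤ) (hi : 1 ≤ i) (hi' : i ≤ C.m) :
    C.PhibarW c (k * C.m + i - 1) = C.psibarS i c k := by
  have hm : (0 : ℤ) < C.m := by exact_mod_cast C.hm
  have hmod : (k * C.m + i - 1 : ℤ).emod C.m = (i : ℤ) - 1 := by
    change (k * C.m + i - 1 : ℤ) % C.m = (i : ℤ) - 1
    rw [show (k * C.m + i - 1 : ℤ) = ((i : ℤ) - 1) + C.m * k by ring, Int.add_mul_emod_self_left]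
    exact Int.emod_eq_of_lt (by omega) (by omega)
  unfold PhibarW psibarS
  rw [hmod, show (k * C.m + i - 1 - ((i : ℤ) - 1) : ℤ) = k * C.m by ring,
    Int.mul_ediv_cancel _ hm.ne', show ((i : ℤ) - 1).toNat + 1 = i by omega]

theorem flat_le_NN {i c : ℕ} (hi' : i ≤ C.m) (hc : 1 ≤ c) (hc' : c ≤ C.n) :
    i + (c - 1) * C.m ≤ C.NN := by
  have h : c * C.m ≤ C.n * C.m := Nat.mul_le_mul_right _ hc'
  obtain ⟨d, rfl⟩ := Nat.exists_eq_add_of_le' hc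
  have : C.NN = C.n * C.m := Nat.mul_comm _ _
  simp only [Nat.add_sub_cancel]
  rw [Nat.add_mul] at h
  omega

theorem flat_inj {i i' c c' : ℕ} (hi : 1 ≤ i) (hi' : i ≤ C.m) (hj : 1 ≤ i') (hj' : i' ≤ C.m)
    (hc : 1 ≤ c) (hc' : 1 ≤ c') :
    i + (c - 1) * C.m = i' + (c' - 1) * C.m ↔ i = i' ∧ c = c' := by
  constructor
  · intro h
    have hcc : c - 1 = c' - 1 := by
      rcases lt_trichotomy (c - 1) (c' - 1) with hlt | heq | hlt
      · have := Nat.mul_le_mul_right C.m hlt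
        rw [Nat.succ_mul] at this
        omega
      · exact heq
      · have := Nat.mul_le_mul_right C.m hlt
        rw [Nat.succ_mul] at this
        omega
    rw [hcc] at h
    omega
  · rintro ⟨rfl, rfl⟩
    rfl

theorem psibarS_mul_psiS {i i' c c' : ℕ} (k k' : ℤ) (hi : 1 ≤ i) (hi' : i ≤ C.m) (hj : 1 ≤ i')
    (hj' : i' ≤ C.m) (hc : 1 ≤ c) (hcn : c ≤ C.n) (hc' : 1 ≤ c') :
    C.psibarS i c k * C.psiS i' c' k' = C.psiS i' c' k' * C.psibarS i c k
      + if (i = i' ∧ c = c') ∧ k + k' + C.sig = 0 then 1 else 0 := by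
  unfold psibarS psiS
  rw [C.psibarF_mul_psiF _ _ _ _ (by omega) (C.flat_le_NN hi' hc hcn)]
  simp only [C.flat_inj hi hi' hj hj' hc hc']

theorem commutator_Esum_psibarS {i j i' c : ℕ} (a k k' : ℤ) (hi : 1 ≤ i) (hi' : i ≤ C.m)
    (hj : 1 ≤ i') (hj' : i' ≤ C.m) (hc : 1 ≤ c) (hcn : c ≤ C.n) :
    C.Esum i j a k * C.psibarS i' c k' - C.psibarS i' c k' * C.Esum i j a k
      = if i' = i ∧ k' = k - a then -C.psibarS j c k else 0 := by
  have term : ∀ d : Fin C.n,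
      C.psiS i ((d : ℕ) + 1) (a - k - C.sig) * C.psibarS j ((d : ℕ) + 1) k * C.psibarS i' c k'
        - C.psibarS i' c k'
          * (C.psiS i ((d : ℕ) + 1) (a - k - C.sig) * C.psibarS j ((d : ℕ) + 1) k)
      = if d = ⟨c - 1, by omega⟩ then (if i' = i ∧ k' = k - a then -C.psibarS j c k else 0)
        else 0 := by
    intro d
    have hcomm : C.psibarS j ((d : ℕ) + 1) k * C.psibarS i' c k'
        = C.psibarS i' c k' * C.psibarS j ((d : ℕ) + 1) k := C.psibarF_commute _ _ _ _
    rw [← mul_assoc (C.psibarS i' c k'), C.psibarS_mul_psiS _ _ hj hj' hi hi' hc hcn (by omega),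
      mul_assoc, hcomm, add_mul, ← mul_assoc, sub_add_cancel_left]
    by_cases hd : (d : ℕ) + 1 = c
    · have hd' : d = ⟨c - 1, by omega⟩ := Fin.ext (by simp; omega)
      rw [if_pos hd']
      by_cases h : i' = i ∧ k' = k - a
      · rw [if_pos ⟨⟨h.1, hd.symm⟩, by omega⟩, if_pos h, one_mul, hd]
      · rw [if_neg (fun hh => h ⟨hh.1.1, by omega⟩), if_neg h, zero_mul, neg_zero]
    · rw [if_neg (fun hh => hd hh.1.2.symm), zero_mul, neg_zero, if_neg]
      rintro rfl
      exact hd (by simp; omega)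
  unfold Esum
  rw [Finset.sum_mul, Finset.mul_sum, ← Finset.sum_sub_distrib,
    Finset.sum_congr rfl fun d _ => term d]
  simp

/-- The action of the commutator with `Esum` on the entries of `Abar`. -/
theorem commutator_Esum_PhibarW {i j c : ℕ} (a k t : ℤ) (hi : 1 ≤ i) (hi' : i ≤ C.m)
    (hj : 1 ≤ j) (hj' : j ≤ C.m) (hc : 1 ≤ c) (hcn : c ≤ C.n) :
    C.Esum i j a k * C.PhibarW c t - C.PhibarW c t * C.Esum i j a k
      = if -t = C.alphaV k a i then -C.PhibarW c (C.betaV k 0 j - 1) else 0 := by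
  have hm : (0 : ℤ) < C.m := by exact_mod_cast C.hm
  obtain ⟨i', k', hi1, him, rfl⟩ : ∃ (i' : ℕ) (k' : ℤ), 1 ≤ i' ∧ i' ≤ C.m
      ∧ t = k' * C.m + i' - 1 := by
    have h1 := Int.emod_nonneg t hm.ne'
    have h2 := Int.emod_lt_of_pos t hm
    have h3 := Int.mul_ediv_add_emod t C.m
    refine ⟨(t % C.m).toNat + 1, t / C.m, by omega, by omega, ?_⟩
    push_cast
    rw [Int.toNat_of_nonneg h1]
    linarith
  have hβ : C.PhibarW c (C.betaV k 0 j - 1) = C.psibarS j c k := by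
    rw [← C.PhibarW_mul_add c j k hj hj', betaV, add_zero]
  have hiff : -(k' * C.m + i' - 1) = C.alphaV k a i ↔ i' = i ∧ k' = k - a := by
    unfold alphaV
    constructor
    · intro h
      have h' : (k' - (k - a)) * C.m = (i : ℤ) - i' := by linarith
      have h0 : k' - (k - a) = 0 := by
        by_contra hne
        rcases lt_or_gt_of_ne hne with hlt | hgt
        · nlinarith
        · nlinarith
      rw [h0, zero_mul] at h'
      omega
    · rintro ⟨rfl, rfl⟩
      ring
  rw [C.PhibarW_mul_add c i' k' hi1 him, C.commutator_Esum_psibarS a k k' hi hi' hi1 him hc hcn, hβ]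
  simp only [hiff]

theorem commutator_ncdet {l : ℕ} (e : C.W) (M : Fin l → Fin l → C.W) :
    e * C.ncdet M - C.ncdet M * e = ∑ p : Equiv.Perm (Fin l),
      (((Equiv.Perm.sign p : ℤˣ) : ℤ)) • (e * ((List.finRange l).map fun t => M (p t) t).prod
        - ((List.finRange l).map fun t => M (p t) t).prod * e) := by
  unfold ncdet
  rw [Finset.sum_mul, Finset.mul_sum, ← Finset.sum_sub_distrib]
  refine Finset.sum_congr rfl fun p _ => ?_
  rw [smul_sub, mul_smul_comm, smul_mul_assoc]

theorem commutator_ncdet_eq_zero {l : ℕ} (e : C.W) (M : Fin l → Fin l → C.W)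
    (h : ∀ s t, e * M s t - M s t * e = 0) : e * C.ncdet M - C.ncdet M * e = 0 := by
  rw [commutator_ncdet]
  refine Finset.sum_eq_zero fun p _ => ?_
  rw [commutator_list_prod_eq_zero, smul_zero]
  simp only [List.mem_map]
  rintro _ ⟨t, -, rfl⟩
  exact h _ _

theorem commutator_ncdet_column {l : ℕ} (e : C.W) (M M' : Fin l → Fin l → C.W) (t₀ : Fin l)
    (h₀ : ∀ s, e * M s t₀ - M s t₀ * e = M' s t₀)
    (h : ∀ s t, t ≠ t₀ → e * M s t - M s t * e = 0) (hM : ∀ s t, t ≠ t₀ → M' s t = M s t) :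
    e * C.ncdet M - C.ncdet M * e = C.ncdet M' := by
  rw [commutator_ncdet]
  refine Finset.sum_congr rfl fun p _ => ?_
  rw [commutator_list_prod e (fun t => M (p t) t) (fun t => M' (p t) t) t₀ (h₀ _)
    (fun t ht => h _ t ht) (fun t ht => hM _ t ht) _ (List.nodup_finRange l),
    if_pos (List.mem_finRange t₀)]

open scoped IsMulCommutative in
theorem ncdet_eq_zero_of_column_eq_neg {l : ℕ} (M : Fin l → Fin l → C.W)
    (hcomm : ∀ s t s' t', Commute (M s t) (M s' t')) {t₀ t₁ : Fin l} (hne : t₀ ≠ t₁)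
    (h : ∀ s, M s t₀ = -M s t₁) : C.ncdet M = 0 := by
  let S : Set C.W := Set.range fun x : Fin l × Fin l => M x.1 x.2
  have : IsMulCommutative (Subring.closure S) := Subring.isMulCommutative_closure (by
    rintro _ ⟨x, rfl⟩ _ ⟨y, rfl⟩
    exact hcomm _ _ _ _)
  let N : Matrix (Fin l) (Fin l) (Subring.closure S) :=
    fun s t => ⟨M s t, Subring.subset_closure ⟨(s, t), rfl⟩⟩
  have hdet : C.ncdet M = (Subring.closure S).subtype N.det := by
    rw [Matrix.det_apply, map_sum]
    refine Finset.sum_congr rfl fun p _ => ?_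
    rw [Units.smul_def, map_zsmul, Fin.prod_univ_def, map_list_prod, List.map_map]
    rfl
  have hN : N = (N.updateCol t₀ fun s => -N s t₁) := by
    ext s t
    by_cases ht : t = t₀
    · subst ht
      rw [Matrix.updateCol_self]
      exact h s
    · simp [ht]
  have hzero : N.det = 0 := by
    rw [hN, show (fun s => -N s t₁) = (-1 : Subring.closure S) • fun s => N s t₁ by ext; simp,
      Matrix.det_updateCol_smul, Matrix.det_zero_of_column_eq hne, mul_zero]
    intro s
    simp [hne.symm]
  rw [hdet, hzero, map_zero]

theorem ncdet_smul_eq_zero {l : ℕ} (M : Fin l → Fin l → C.W)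
    (hcomm : ∀ s t s' t', Commute (M s t) (M s' t')) (t₀ : Fin l) (v : C.F)
    (h : ∀ s, M s t₀ • v = 0) : C.ncdet M • v = 0 := by
  unfold ncdet
  rw [Finset.sum_smul]
  refine Finset.sum_eq_zero fun p _ => ?_
  rw [smul_assoc, list_prod_smul_eq_zero (M (p t₀) t₀) v (h _), smul_zero]
  · simp only [List.mem_map]
    rintro _ ⟨t, -, rfl⟩
    exact hcomm _ _ _ _
  · exact List.mem_map.2 ⟨t₀, List.mem_finRange _, rfl⟩

theorem psibarF_smul_vac (I : ℕ) {k : ℤ} (hk : 0 ≤ k) : C.psibarF I k • C.vac = 0 := by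
  unfold psibarF
  split_ifs with h
  · have hmem : C.psibar0 ⟨I - 1, by omega⟩ k ∈ C.vacIdeal := by
      refine Submodule.subset_span ?_
      rcases C.hsig with hs | hs
      · rcases hk.eq_or_lt with rfl | hk
        · exact Or.inr ⟨hs, _, rfl⟩
        · exact Or.inl ⟨_, k, by omega, Or.inr rfl⟩
      · exact Or.inl ⟨_, k, by omega, Or.inr rfl⟩
    have := (Submodule.Quotient.mk_eq_zero C.vacIdeal).2 hmem
    rw [← mul_one (C.psibar0 _ k)] at this
    exact this
  · exact zero_smul _ _

theorem PhibarW_smul_vac (c : ℕ) {t : ℤ} (ht : 0 ≤ t) : C.PhibarW c t • C.vac = 0 := by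
  have hm : (0 : ℤ) < C.m := by exact_mod_cast C.hm
  refine C.psibarF_smul_vac _ (Int.ediv_nonneg ?_ hm.le)
  have h1 : t % C.m ≤ t := by
    have := mul_nonneg hm.le (Int.ediv_nonneg ht hm.le)
    have := Int.mul_ediv_add_emod t C.m
    omega
  exact sub_nonneg.2 h1

theorem Abarmod_entry_commute (l i j : ℕ) (a k : ℤ) (c : ℕ) (x : ℤ)
    (s t : Fin (C.n - l + 1)) :
    Commute (C.PhibarW c x)
      (if (((t : ℕ) : ℤ) + 1) = C.alphaV k a i then -C.PhibarW (C.n - (s : ℕ)) (C.betaV k 0 j - 1)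
        else C.PhibarW (C.n - (s : ℕ)) (-(((t : ℕ) : ℤ) + 1))) := by
  split_ifs
  · exact (C.PhibarW_commute _ _ _ _).neg_right
  · exact C.PhibarW_commute _ _ _ _

theorem Abar_commute_Abarmod (l l' i j : ℕ) (a k : ℤ) :
    C.Abar l' * C.Abarmod l i j a k - C.Abarmod l i j a k * C.Abar l' = 0 := by
  refine C.commutator_ncdet_eq_zero _ _ fun s t => ?_
  rw [← neg_sub, neg_eq_zero]
  refine C.commutator_ncdet_eq_zero _ _ fun s' t' => ?_
  exact sub_eq_zero.2 (C.Abarmod_entry_commute l i j a k _ _ s t).symm.eq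

end WCtx

open WCtx in
/-- **Lemma 5.4.**  For `1 ≤ i,j ≤ m`, `a ∈ ℤ`, `r ∈ S` (encoded by `k`), `1 ≤ l ≤ n`,
with `a > 0`, or `a = 0` and `i < j`:  if `α(r,a,i) ∉ I_{n-l+1}` then
`[Σ_c ψ_i^c(a-r)ψ̄_j^c(r), Ā_l] = 0`; if `α(r,a,i) ∈ I_{n-l+1}` then this commutator
equals `Ā_l^{i,j,r}`, and moreover `[Ā_{l'}, Ā_l^{i,j,r}] = 0` for `l ≤ l' ≤ n` and
`Ā_l^{i,j,r}|0⟩ = 0`. -/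
theorem statement7 (C : WCtx) (i j : ℕ) (hi : 1 ≤ i) (hi' : i ≤ C.m)
    (hj : 1 ≤ j) (hj' : j ≤ C.m) (a k : ℤ) (l : ℕ) (hl : 1 ≤ l) (hl' : l ≤ C.n)
    (ha : 0 < a ∨ (a = 0 ∧ i < j)) :
    (¬ (1 ≤ C.alphaV k a i ∧ C.alphaV k a i ≤ ((C.n - l + 1 : ℕ) : ℤ)) →
      C.Esum i j a k * C.Abar l - C.Abar l * C.Esum i j a k = 0)
    ∧
    ((1 ≤ C.alphaV k a i ∧ C.alphaV k a i ≤ ((C.n - l + 1 : ℕ) : ℤ)) →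
      (C.Esum i j a k * C.Abar l - C.Abar l * C.Esum i j a k = C.Abarmod l i j a k)
      ∧ (∀ l' : ℕ, l ≤ l' → l' ≤ C.n →
          C.Abar l' * C.Abarmod l i j a k - C.Abarmod l i j a k * C.Abar l' = 0)
      ∧ C.Abarmod l i j a k • C.vac = 0) := by
  have entry : ∀ s t : Fin (C.n - l + 1),
      C.Esum i j a k * C.PhibarW (C.n - (s : ℕ)) (-(((t : ℕ) : ℤ) + 1))
        - C.PhibarW (C.n - (s : ℕ)) (-(((t : ℕ) : ℤ) + 1)) * C.Esum i j a k
      = if (((t : ℕ) : ℤ) + 1) = C.alphaV k a i then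
          -C.PhibarW (C.n - (s : ℕ)) (C.betaV k 0 j - 1) else 0 := by
    intro s t
    have := C.commutator_Esum_PhibarW (j := j) (c := C.n - (s : ℕ)) a k (-(((t : ℕ) : ℤ) + 1))
      hi hi' hj hj' (by omega) (by omega)
    rwa [neg_neg] at this
  refine ⟨fun hα => ?_, fun hα => ?_⟩
  · refine C.commutator_ncdet_eq_zero _ _ fun s t => ?_
    rw [entry, if_neg]
    intro h
    exact hα (by omega)
  · obtain ⟨t₀, ht₀⟩ : ∃ t₀ : Fin (C.n - l + 1), (((t₀ : ℕ) : ℤ) + 1) = C.alphaV k a i :=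
      ⟨⟨(C.alphaV k a i - 1).toNat, by omega⟩, by simp only; omega⟩
    have hne : ∀ t : Fin (C.n - l + 1), t ≠ t₀ → (((t : ℕ) : ℤ) + 1) ≠ C.alphaV k a i :=
      fun t ht h => ht (Fin.ext (by omega))
    refine ⟨?_, fun l' _ _ => C.Abar_commute_Abarmod l l' i j a k, ?_⟩
    · refine C.commutator_ncdet_column _ _ _ t₀ (fun s => ?_) (fun s t ht => ?_)
        (fun s t ht => if_neg (hne t ht))
      · simp only [entry, if_pos ht₀]
      · simp only [entry, if_neg (hne t ht)]
    · have hlt : 1 - C.betaV k 0 j < C.alphaV k a i := by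
        unfold alphaV betaV
        rcases ha with ha | ⟨rfl, hij⟩
        · have := mul_le_mul_of_nonneg_right (show (1 : ℤ) ≤ a by omega)
            (show (0 : ℤ) ≤ C.m by omega)
          rw [one_mul] at this
          have h2 : (a - k) * (C.m : ℤ) = a * C.m - k * C.m := by ring
          rw [add_zero]
          omega
        · rw [zero_sub, add_zero, neg_mul]
          omega
      have hcomm : ∀ s t s' t' : Fin (C.n - l + 1), Commute
          (if (((t : ℕ) : ℤ) + 1) = C.alphaV k a i then
            -C.PhibarW (C.n - (s : ℕ)) (C.betaV k 0 j - 1)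
            else C.PhibarW (C.n - (s : ℕ)) (-(((t : ℕ) : ℤ) + 1)))
          (if (((t' : ℕ) : ℤ) + 1) = C.alphaV k a i then
            -C.PhibarW (C.n - (s' : ℕ)) (C.betaV k 0 j - 1)
            else C.PhibarW (C.n - (s' : ℕ)) (-(((t' : ℕ) : ℤ) + 1))) := by
        intro s t s' t'
        have := fun c x => C.Abarmod_entry_commute l i j a k c x s' t'
        split_ifs at this ⊢
        exacts [(this _ _).neg_left, (this _ _).neg_left, this _ _, this _ _]
      rcases le_or_gt 1 (C.betaV k 0 j) with hβ | hβ
      · refine C.ncdet_smul_eq_zero _ hcomm t₀ _ fun s => ?_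
        rw [if_pos ht₀, neg_smul, C.PhibarW_smul_vac _ (by omega), neg_zero]
      · have hzero : C.Abarmod l i j a k = 0 := by
          refine C.ncdet_eq_zero_of_column_eq_neg _ hcomm (t₀ := t₀)
            (t₁ := ⟨(-C.betaV k 0 j).toNat, by omega⟩) ?_ fun s => ?_
          · intro h
            have := congrArg Fin.val h
            simp only at this
            omega
          · have h1 : (((-C.betaV k 0 j).toNat : ℕ) : ℤ) = -C.betaV k 0 j := by omega
            simp only [h1]
            rw [if_pos ht₀, if_neg (by omega), show -(-C.betaV k 0 j + 1) = C.betaV k 0 j - 1 by ring]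
        rw [hzero, zero_smul]
end
end
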